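/- For i = 1,…,s let k_i ∈ ℕ, let y_i = Σ_{j≥1} y_{i,j} u_i^{-j} with y_{i,j} ∈ {0,…,u_i−1} and y_{i,k_i} > 0, let t ∈ ℕ with t ≥ k_i for all i, let v̄_i ∈ ℕ with v_i·v̄_i ≡ 1 (mod u_i^{k_i}), and let M_{i,k} ∈ ℕ satisfy M_{i,k}·Π_{j≠i} u_j^{k_j} ≡ 1 (mod u_i^{k_i}). Write U_k = Π_{i=1}^s u_i^{k_i}, ẏ_{i,k_i} = Σ_{j=1}^{k_i} σ_{i,j}^{-1}(y_{i,j})·u_i^{j−1}·v̄_i^j, ÿ_k = Σ_{i=1}^s M_{i,k}·(U_k/u_i^{k_i})·ẏ_{i,k_i}, and let b_i ∈ {1,…,u_i−1} satisfy b_i ≡ σ_{i,k_i}^{-1}(y_{i,k_i} − 1) − σ_{i,k_i}^{-1}(y_{i,k_i}) (mod u_i). Then for every n ∈ ℕ₀: [φ^{Σ_i}_{u_i/v_i}(n)]_t ∈ [[y_i]_{k_i} − 1/u_i^{k_i}, [y_i]_{k_i}) for all i = 1,…,s if and only if n ≡ ÿ_k + Σ_{i=1}^s M_{i,k}·(U_k/u_i)·b_i·v̄_i^{k_i}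 (mod U_k). -/

import Mathlib

open Finset

/-- The auxiliary integers `z_r` in the formal `u/v`-adic expansion of an integer `z`:
`z_0 = z` and `z_{r+1} = (v·z_r − a_{r+1})/u`, where `a_{r+1} = (v·z_r) mod u` is the unique
element of `{0,…,u−1}` with `u ∣ (v·z_r − a_{r+1})`. -/
def ratZ (u v : ℕ) (z : ℤ) : ℕ → ℤ
  | 0 => z
  | r + 1 => ((v : ℤ) * ratZ u v z r - ((v : ℤ) * ratZ u v z r) % (u : ℤ)) / (u : ℤ)

/-- `ratDigit u v z r` is the digit `a_{r+1}` of the formal `u/v`-adic expansion of `z`,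
i.e. the unique element of `{0,…,u−1}` with `u ∣ (v·z_r − a_{r+1})`. -/
def ratDigit (u v : ℕ) (z : ℤ) (r : ℕ) : ℕ :=
  (((v : ℤ) * ratZ u v z r) % (u : ℤ)).toNat

/-- The generalized `u/v`-adic radical inverse function
`φ^Σ_{u/v}(n) = Σ_{r≥1} σ_r(a_r)/u^r`, where `σ r` is the permutation `σ_{r+1}` of
`{0,…,u−1}` and `a_{r+1} = ratDigit u v n r`. -/
noncomputable def ratPhi (u v : ℕ) (σ : ℕ → ℕ → ℕ) (n : ℕ) : ℝ :=
  ∑' r : ℕ, (σ r (ratDigit u v (n : ℤ) r) : ℝ) / (u : ℝ) ^ (r + 1)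

/-- The truncation `[φ^Σ_{u/v}(n)]_t = Σ_{r=1}^t σ_r(a_r)/u^r` of the generalized
`u/v`-adic radical inverse function to its first `t` prescribed digits. -/
noncomputable def ratPhiTrunc (u v : ℕ) (σ : ℕ → ℕ → ℕ) (t n : ℕ) : ℝ :=
  ∑ r ∈ Finset.range t, (σ r (ratDigit u v (n : ℤ) r) : ℝ) / (u : ℝ) ^ (r + 1)

/-- The star discrepancy `D*_N` of the first `N` points of the sequence `x` in `[0,1]^s`:
`D*_N = sup_{y ∈ (0,1]^s} |#{0 ≤ n < N : x_n^{(i)} < y^{(i)}, i=1,…,s}/N − Π_i y^{(i)}|`. -/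
noncomputable def starDisc (s N : ℕ) (x : ℕ → Fin s → ℝ) : ℝ :=
  sSup { d : ℝ | ∃ y : Fin s → ℝ, (∀ i, y i ∈ Set.Ioc (0 : ℝ) 1) ∧
    d = |(Nat.card {n : ℕ | n < N ∧ ∀ i, x n i < y i} : ℝ) / N - ∏ i, y i| }

lemma ratZ_succ' (u v : ℕ) (z : ℤ) (r : ℕ) : ratZ u v z (r + 1) = ratZ u v (ratZ u v z 1) r := by
  induction r with
  | zero => rfl
  | succ r ih =>
    rw [ratZ, ih]
    rfl

lemma ratDigit_succ (u v : ℕ) (z : ℤ) (r : ℕ) :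
    ratDigit u v z (r + 1) = ratDigit u v (ratZ u v z 1) r := by
  rw [ratDigit, ratZ_succ', ratDigit]

lemma ratDigit_lt {u : ℕ} (hu : 0 < u) (v : ℕ) (z : ℤ) (r : ℕ) : ratDigit u v z r < u := by
  have h := Int.emod_lt_of_pos ((v : ℤ) * ratZ u v z r) (by exact_mod_cast hu : (0 : ℤ) < u)
  have h' := Int.emod_nonneg ((v : ℤ) * ratZ u v z r) (by exact_mod_cast hu.ne' : (u : ℤ) ≠ 0)
  unfold ratDigit
  omega

lemma mul_eq_ratDigit_add {u : ℕ} (hu : 0 < u) (v : ℕ) (z : ℤ) :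
    (v : ℤ) * z = ratDigit u v z 0 + u * ratZ u v z 1 := by
  have h' := Int.emod_nonneg ((v : ℤ) * z) (by exact_mod_cast hu.ne' : (u : ℤ) ≠ 0)
  have hd : ((ratDigit u v z 0 : ℕ) : ℤ) = (v * z) % u := by
    simp only [ratDigit, ratZ]
    exact Int.toNat_of_nonneg h'
  rw [hd]
  simp only [ratZ]
  rw [Int.mul_ediv_cancel' (Int.dvd_self_sub_emod)]
  ring

/-- The first `k` digits of the `u/v`-adic expansion of `z` determine `z` modulo `u ^ k`. -/
lemma ratDigit_eq_iff_modEq {u v w : ℕ} (hu : 0 < u) (k : ℕ) :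
    v * w ≡ 1 [MOD u ^ k] → ∀ (d : ℕ → ℕ) (_ : ∀ j, d j < u) (z : ℤ),
      (∀ j < k, ratDigit u v z j = d j) ↔
        z ≡ ∑ j ∈ range k, (d j : ℤ) * u ^ j * w ^ (j + 1) [ZMOD (u : ℤ) ^ k] := by
  induction k with
  | zero => intro _ d _ z; simp [Int.modEq_one]
  | succ k ih =>
    intro hw d hd z
    have ih' := ih (hw.of_dvd (pow_dvd_pow u k.le_succ)) (fun j => d (j + 1))
      (fun j => hd (j + 1)) (ratZ u v z 1)
    rw [Nat.forall_lt_succ_left]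
    simp only [ratDigit_succ]
    rw [ih', sum_range_succ']
    set S : ℤ := ∑ j ∈ range k, (d (j + 1) : ℤ) * u ^ j * w ^ (j + 1) with hS
    have hsum : ∑ j ∈ range k, (d (j + 1) : ℤ) * u ^ (j + 1) * w ^ (j + 1 + 1) = u * w * S := by
      rw [hS, mul_sum]
      exact sum_congr rfl fun j _ => by ring
    rw [hsum]
    have hmul := mul_eq_ratDigit_add hu v z
    have hlt := ratDigit_lt hu v z 0
    set a := ratDigit u v z 0
    set q := ratZ u v z 1
    obtain ⟨c, hc⟩ : (u : ℤ) ^ (k + 1) ∣ 1 - v * w := by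
      have := (Nat.modEq_iff_dvd.mp hw)
      push_cast at this
      exact this
    have hco : IsCoprime ((u : ℤ) ^ (k + 1)) v := ⟨c, w, by linear_combination -hc⟩
    have hu0 : (u : ℤ) ≠ 0 := by exact_mod_cast hu.ne'
    have key : (u : ℤ) ^ (k + 1) ∣ (u * w * S + d 0 * u ^ 0 * w ^ (0 + 1)) - z ↔
        (u : ℤ) ^ (k + 1) ∣ (d 0 - a) + u * (S - q) := by
      have : (d 0 - a : ℤ) + u * (S - q) =
          v * (u * w * S + d 0 * u ^ 0 * w ^ (0 + 1) - z) + u ^ (k + 1) * (c * (u * S + d 0)) := by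
        linear_combination (u * S + d 0) * hc + hmul
      rw [this, dvd_add_left (dvd_mul_right _ _)]
      exact ⟨fun h => h.mul_left _, hco.dvd_of_dvd_mul_left⟩
    rw [Int.modEq_iff_dvd, Int.modEq_iff_dvd, key]
    constructor
    · rintro ⟨h0, h⟩
      rw [h0, sub_self, zero_add, pow_succ']
      exact mul_dvd_mul_left _ h
    · intro h
      have h1 : (u : ℤ) ∣ (d 0 - a : ℤ) :=
        (dvd_add_left (dvd_mul_right _ _)).mp ((dvd_pow_self _ k.succ_ne_zero).trans h)
      have h2 : a = d 0 := Nat.ModEq.eq_of_lt_of_lt (Nat.modEq_iff_dvd.mpr h1) hlt (hd 0)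
      refine ⟨h2, ?_⟩
      rw [h2, sub_self, zero_add, pow_succ'] at h
      exact (mul_dvd_mul_iff_left hu0).mp h

lemma sum_div_pow_succ_succ (u : ℕ) (c : ℕ → ℕ) (t : ℕ) :
    ∑ j ∈ range (t + 1), (c j : ℝ) / (u : ℝ) ^ (j + 1) =
      (c 0 + ∑ j ∈ range t, (c (j + 1) : ℝ) / (u : ℝ) ^ (j + 1)) / u := by
  rw [sum_range_succ', add_div, sum_div, add_comm]
  congr 1
  · simp
  · exact sum_congr rfl fun j _ => by rw [pow_succ _ (j + 1), div_div]

lemma sum_div_pow_succ_add_le {u : ℕ} (hu : 0 < u) (c : ℕ → ℕ) (hc : ∀ j, c j < u) (t : ℕ) :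
    ∑ j ∈ range t, (c j : ℝ) / (u : ℝ) ^ (j + 1) + 1 / (u : ℝ) ^ t ≤ 1 := by
  induction t with
  | zero => simp
  | succ t ih =>
    have hu' : (0 : ℝ) < u := by exact_mod_cast hu
    have h : (c t : ℝ) + 1 ≤ u := by exact_mod_cast hc t
    have : (c t : ℝ) / (u : ℝ) ^ (t + 1) + 1 / (u : ℝ) ^ (t + 1) ≤ 1 / (u : ℝ) ^ t := by
      rw [← add_div, div_le_div_iff₀ (by positivity) (by positivity), pow_succ]
      nlinarith [pow_pos hu' t]
    rw [sum_range_succ]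
    linarith

/-- A finite `u`-adic expansion lies in an elementary interval of length `u⁻ᵏ` iff its first `k`
digits are those of the left endpoint. -/
lemma sum_div_pow_mem_Ico_iff {u : ℕ} (hu : 0 < u) (k : ℕ) :
    ∀ (t : ℕ) (_ : k ≤ t) (c d : ℕ → ℕ) (_ : ∀ j, c j < u) (_ : ∀ j, d j < u),
      ∑ j ∈ range t, (c j : ℝ) / (u : ℝ) ^ (j + 1) ∈
        Set.Ico (∑ j ∈ range k, (d j : ℝ) / (u : ℝ) ^ (j + 1))
          (∑ j ∈ range k, (d j : ℝ) / (u : ℝ) ^ (j + 1) + 1 / (u : ℝ) ^ k) ↔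
      ∀ j < k, c j = d j := by
  have hu' : (0 : ℝ) < u := by exact_mod_cast hu
  induction k with
  | zero =>
    intro t _ c d hc _
    have h := sum_div_pow_succ_add_le hu c hc t
    have h' : (0 : ℝ) < 1 / (u : ℝ) ^ t := by positivity
    simp only [range_zero, sum_empty, pow_zero, Set.mem_Ico, not_lt_zero, false_imp_iff,
      implies_true, iff_true]
    exact ⟨by positivity, by linarith⟩
  | succ k ih =>
    intro t ht c d hc hd
    obtain ⟨t, rfl⟩ : ∃ t', t = t' + 1 := ⟨t - 1, by omega⟩
    have ih' := ih t (by omega) (fun j => c (j + 1)) (fun j => d (j + 1))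
      (fun j => hc _) (fun j => hd _)
    have hC := sum_div_pow_succ_add_le hu (fun j => c (j + 1)) (fun j => hc _) t
    have hD := sum_div_pow_succ_add_le hu (fun j => d (j + 1)) (fun j => hd _) k
    have hpt : (0 : ℝ) < 1 / (u : ℝ) ^ t := by positivity
    have hC0 : 0 ≤ ∑ j ∈ range t, (c (j + 1) : ℝ) / (u : ℝ) ^ (j + 1) := by positivity
    have hD0 : 0 ≤ ∑ j ∈ range k, (d (j + 1) : ℝ) / (u : ℝ) ^ (j + 1) := by positivity
    rw [Nat.forall_lt_succ_left, ← ih', sum_div_pow_succ_succ, sum_div_pow_succ_succ,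
      pow_succ, ← div_div, ← add_div, Set.mem_Ico, Set.mem_Ico,
      div_le_div_iff_of_pos_right hu', div_lt_div_iff_of_pos_right hu']
    constructor
    · rintro ⟨h1, h2⟩
      have e1 : (c 0 : ℝ) < d 0 + 1 := by linarith
      have e2 : (d 0 : ℝ) < c 0 + 1 := by linarith
      have e : c 0 = d 0 := by
        have e1' : c 0 < d 0 + 1 := by exact_mod_cast e1
        have e2' : d 0 < c 0 + 1 := by exact_mod_cast e2
        omega
      rw [e] at h1 h2
      exact ⟨e, by linarith, by linarith⟩
    · rintro ⟨e, h1, h2⟩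
      rw [e]
      exact ⟨by linarith, by linarith⟩

/-- Chinese remainder theorem: `∑ i, a i * x i` with `a i ≡ 1` modulo `m i` and
`a i ≡ 0` modulo the other moduli is the solution of `n ≡ x i` modulo `m i`. -/
lemma modEq_prod_iff_forall_modEq {ι : Type*} [Fintype ι] [DecidableEq ι] (m M x : ι → ℕ)
    (hcop : ∀ i j, i ≠ j → Nat.Coprime (m i) (m j))
    (hM : ∀ i, M i * ∏ j ∈ univ.erase i, m j ≡ 1 [MOD m i]) (n : ℕ) :
    n ≡ ∑ i, M i * (∏ j ∈ univ.erase i, m j) * x i [MOD ∏ i, m i] ↔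
      ∀ i, n ≡ x i [MOD m i] := by
  have hsol : ∀ i, ∑ l, M l * (∏ j ∈ univ.erase l, m j) * x l ≡ x i [MOD m i] := by
    intro i
    rw [← add_sum_erase _ _ (mem_univ i)]
    have h1 : m i ∣ ∑ l ∈ univ.erase i, M l * (∏ j ∈ univ.erase l, m j) * x l :=
      dvd_sum fun l hl => Dvd.dvd.mul_right (Dvd.dvd.mul_left
        (dvd_prod_of_mem m (mem_erase.mpr ⟨(ne_of_mem_erase hl).symm, mem_univ i⟩)) _) _
    simpa using ((hM i).mul_right (x i)).add (Nat.modEq_zero_iff_dvd.mpr h1)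
  constructor
  · intro h i
    exact (h.of_dvd (dvd_prod_of_mem m (mem_univ i))).trans (hsol i)
  · intro h
    rw [Nat.modEq_iff_dvd]
    push_cast
    refine Finset.prod_dvd_of_coprime (fun i _ j _ hij => ?_) fun i _ => ?_
    · exact Nat.isCoprime_iff_coprime.mpr (hcop i j hij)
    · have := Nat.modEq_iff_dvd.mp ((h i).trans (hsol i).symm)
      push_cast at this
      exact this

/-- **Lemma 2, item 4.** With `b_i ∈ {1,…,u_i−1}` satisfying
`b_i ≡ σ_{i,k_i}^{-1}(y_{i,k_i} − 1) − σ_{i,k_i}^{-1}(y_{i,k_i}) (mod u_i)`: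
`[φ^{Σ_i}_{u_i/v_i}(n)]_t ∈ [[y_i]_{k_i} − 1/u_i^{k_i}, [y_i]_{k_i})` for all `i = 1,…,s`
iff `n ≡ ÿ_k + Σ_i M_{i,k}·(U_k/u_i)·b_i·v̄_i^{k_i} (mod U_k)`. -/
theorem halton_ratPhiTrunc_forall_mem_Ico_left_iff_modEq
    (s : ℕ) (hs : 1 ≤ s) (u v : Fin s → ℕ)
    (hu : ∀ i, 2 ≤ u i) (hv : ∀ i, 1 ≤ v i)
    (huv : ∀ i, Nat.Coprime (u i) (v i))
    (hcop : ∀ i j, i ≠ j → Nat.Coprime (u i) (u j))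
    (σ σinv : Fin s → ℕ → ℕ → ℕ)
    (hσ : ∀ i r, Set.BijOn (σ i r) (Set.Iio (u i)) (Set.Iio (u i)))
    (hinv : ∀ i r, Set.InvOn (σinv i r) (σ i r) (Set.Iio (u i)) (Set.Iio (u i)))
    (hinvmap : ∀ i r, Set.MapsTo (σinv i r) (Set.Iio (u i)) (Set.Iio (u i)))
    (k : Fin s → ℕ) (hk : ∀ i, 1 ≤ k i) (t : ℕ) (hkt : ∀ i, k i ≤ t)
    (y : Fin s → ℕ → ℕ) (hy : ∀ i j, y i j < u i) (hyk : ∀ i, 0 < y i (k i - 1))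
    (vbar : Fin s → ℕ) (hvbar : ∀ i, v i * vbar i ≡ 1 [MOD u i ^ k i])
    (M : Fin s → ℕ)
    (hM : ∀ i, M i * ∏ j ∈ Finset.univ.erase i, u j ^ k j ≡ 1 [MOD u i ^ k i])
    (b : Fin s → ℕ) (hb1 : ∀ i, 1 ≤ b i) (hb2 : ∀ i, b i < u i)
    (hbcong : ∀ i, (b i : ℤ) ≡ (σinv i (k i - 1) (y i (k i - 1) - 1) : ℤ) -
      (σinv i (k i - 1) (y i (k i - 1)) : ℤ) [ZMOD (u i : ℤ)])
    (n : ℕ) :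
    (∀ i, ratPhiTrunc (u i) (v i) (σ i) t n ∈
        Set.Ico ((∑ j ∈ Finset.range (k i), (y i j : ℝ) / (u i : ℝ) ^ (j + 1)) -
            1 / (u i : ℝ) ^ k i)
          (∑ j ∈ Finset.range (k i), (y i j : ℝ) / (u i : ℝ) ^ (j + 1))) ↔
      n ≡ (∑ i, M i * (∏ j ∈ Finset.univ.erase i, u j ^ k j) *
          (∑ j ∈ Finset.range (k i), σinv i j (y i j) * u i ^ j * vbar i ^ (j + 1))) +
        (∑ i, M i * ((∏ j ∈ Finset.univ.erase i, u j ^ k j) * u i ^ (k i - 1)) *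
          (b i * vbar i ^ k i))
        [MOD ∏ i, u i ^ k i] := by
  have hsum : (∑ i, M i * (∏ j ∈ Finset.univ.erase i, u j ^ k j) *
          (∑ j ∈ Finset.range (k i), σinv i j (y i j) * u i ^ j * vbar i ^ (j + 1))) +
        (∑ i, M i * ((∏ j ∈ Finset.univ.erase i, u j ^ k j) * u i ^ (k i - 1)) *
          (b i * vbar i ^ k i)) =
      ∑ i, M i * (∏ j ∈ Finset.univ.erase i, u j ^ k j) *
        ((∑ j ∈ Finset.range (k i), σinv i j (y i j) * u i ^ j * vbar i ^ (j + 1)) +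
          b i * u i ^ (k i - 1) * vbar i ^ k i) := by
    rw [← sum_add_distrib]
    exact sum_congr rfl fun i _ => by ring
  rw [hsum, modEq_prod_iff_forall_modEq (fun i => u i ^ k i) M _
    (fun i j hij => (hcop i j hij).pow _ _) hM]
  refine forall_congr' fun i => ?_
  have hui : 0 < u i := by have := hu i; omega
  obtain ⟨K, hK⟩ : ∃ K, k i = K + 1 := ⟨k i - 1, by have := hk i; omega⟩
  have hKt := hkt i
  have hyK := hyk i
  have hbK := hbcong i
  have hvK := hvbar i
  rw [hK] at hKt hyK hbK hvK ⊢
  rw [Nat.add_sub_cancel] at hyK hbK ⊢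
  set d : ℕ → ℕ := fun j => if j = K then y i K - 1 else y i j with hd
  have hdlt : ∀ j, d j < u i := fun j => by
    have h1 := hy i j
    have h2 := hy i K
    simp only [hd]
    split_ifs <;> omega
  have hdK : d K = y i K - 1 := if_pos rfl
  have hdne : ∀ j ∈ range K, d j = y i j := fun j hj => if_neg (mem_range.mp hj).ne
  have hsumd : ∑ j ∈ range (K + 1), (y i j : ℝ) / (u i : ℝ) ^ (j + 1) =
      ∑ j ∈ range (K + 1), (d j : ℝ) / (u i : ℝ) ^ (j + 1) + 1 / (u i : ℝ) ^ (K + 1) := by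
    rw [sum_range_succ, sum_range_succ, hdK, Nat.cast_sub hyK,
      sum_congr rfl fun j hj => show (d j : ℝ) / (u i : ℝ) ^ (j + 1) =
        y i j / (u i : ℝ) ^ (j + 1) by rw [hdne j hj]]
    push_cast
    ring
  have hdig : ∀ j, ratDigit (u i) (v i) n j < u i := ratDigit_lt hui _ _
  rw [hsumd, add_sub_cancel_right, ratPhiTrunc,
    sum_div_pow_mem_Ico_iff hui (K + 1) t hKt (fun r => σ i r (ratDigit (u i) (v i) n r)) d
      (fun j => (hσ i j).mapsTo (hdig j)) hdlt]
  have hperm : ∀ j, σ i j (ratDigit (u i) (v i) n j) = d j ↔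
      ratDigit (u i) (v i) n j = σinv i j (d j) := fun j =>
    ⟨fun h => by rw [← h, (hinv i j).1 (hdig j)], fun h => by rw [h, (hinv i j).2 (hdlt j)]⟩
  simp only [hperm]
  rw [ratDigit_eq_iff_modEq hui (K + 1) hvK (fun j => σinv i j (d j))
    (fun j => hinvmap i j (hdlt j)), ← Int.natCast_modEq_iff]
  have hcong : ∑ j ∈ range (K + 1), ((σinv i j (d j) : ℕ) : ℤ) * (u i : ℤ) ^ j *
        (vbar i : ℤ) ^ (j + 1) ≡
      (((∑ j ∈ range (K + 1), σinv i j (y i j) * u i ^ j * vbar i ^ (j + 1)) +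
        b i * u i ^ K * vbar i ^ (K + 1) : ℕ) : ℤ) [ZMOD (u i : ℤ) ^ (K + 1)] := by
    obtain ⟨e, he⟩ := Int.modEq_iff_dvd.mp hbK
    rw [Int.modEq_iff_dvd]
    push_cast
    rw [sum_range_succ, sum_range_succ, hdK,
      sum_congr rfl fun j hj => show (σinv i j (d j) : ℤ) * u i ^ j * vbar i ^ (j + 1) =
        σinv i j (y i j) * u i ^ j * vbar i ^ (j + 1) by rw [hdne j hj]]
    refine ⟨-e * (vbar i : ℤ) ^ (K + 1), ?_⟩
    linear_combination (-(u i : ℤ) ^ K * (vbar i : ℤ) ^ (K + 1)) * he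
  rw [Nat.cast_pow]
  exact ⟨fun h => h.trans hcong, fun h => h.trans hcong.symm⟩
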